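/- Let R be a Prüfer v-multiplication domain that is not a field, let x be a nonzero nonunit of R, let P be a prime ideal of R minimal over xR, and let I = xR_P ∩ R. If I is w-basic, then P is a maximal t-ideal of R. -/

import Mathlib

open scoped nonZeroDivisors

section

variable {R : Type*} (K : Type*) [CommRing R] [IsDomain R] [Field K]
  [Algebra R K] [IsFractionRing R K]

/-- The `t`-operation on (nonzero) fractional ideals of `R`:
`I_t = ⋃ J_v`, where `J` ranges over the nonzero finitely generated subideals of `I` and
`J_v = (J⁻¹)⁻¹` (realized as a supremum of `R`-submodules of `K`). -/
noncomputable def tOp (I : FractionalIdeal R⁰ K) : Submodule R K :=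
  ⨆ (J : FractionalIdeal R⁰ K) (_ : J ≠ 0) (_ : J ≤ I) (_ : (J : Submodule R K).FG),
    (((J⁻¹)⁻¹ : FractionalIdeal R⁰ K) : Submodule R K)

/-- An integral ideal `M` of `R` is a `t`-ideal if `M_t = M`. -/
def IsTIdeal (M : Ideal R) : Prop :=
  tOp K (M : FractionalIdeal R⁰ K) = ((M : FractionalIdeal R⁰ K) : Submodule R K)

/-- `M` is a maximal `t`-ideal of `R`: maximal among the proper integral `t`-ideals. -/
def IsMaxTIdeal (M : Ideal R) : Prop :=
  M ≠ ⊤ ∧ IsTIdeal K M ∧ ∀ N : Ideal R, N ≠ ⊤ → IsTIdeal K N → M ≤ N → M = N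

/-- The extension `A·R_M` of an `R`-submodule `A` of `K` to the localization `R_M ⊆ K`
(for `M` a prime ideal of `R`): the set of fractions `a/t` with `a ∈ A`, `t ∉ M`. -/
noncomputable def locMul (M : Ideal R) (A : Submodule R K) : Submodule R K :=
  ⨆ (t : R) (_ : t ∉ M), Submodule.span R {(algebraMap R K t)⁻¹} * A

/-- The `w`-operation: `I_w = ⋂ I·R_M`, the intersection taken over all maximal `t`-ideals
`M` of `R`. -/
noncomputable def wOp (I : FractionalIdeal R⁰ K) : Submodule R K :=
  ⨅ (M : Ideal R) (_ : IsMaxTIdeal K M), locMul K M (I : Submodule R K)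

/-- `R` is a Prüfer `v`-multiplication domain: every nonzero finitely generated ideal is
`t`-invertible. -/
def IsPvMD : Prop :=
  ∀ I : Ideal R, I ≠ ⊥ → I.FG →
    tOp K ((I : FractionalIdeal R⁰ K) * (I : FractionalIdeal R⁰ K)⁻¹) = 1

end

/-- The ideal `x·R_P ∩ R` of `R`: the contraction to `R` of the extension of `xR` to the
localization `R_P ⊆ K`. -/
noncomputable def contrLoc {R : Type*} (K : Type*) [CommRing R] [IsDomain R] [Field K]
    [Algebra R K] [IsFractionRing R K] (P : Ideal R) (x : R) : Ideal R :=
  (locMul K P (Submodule.map (Algebra.linearMap R K) (Ideal.span {x}))).comap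
    (Algebra.linearMap R K)

/-- Divisibility form of membership in the v-closure of `F`. -/
def InV {R : Type*} [CommRing R] (F : Ideal R) (y : R) : Prop :=
  ∀ a b : R, a ≠ 0 → (∀ f ∈ F, a ∣ b * f) → a ∣ b * y

section helpers

variable {R : Type*} {K : Type*} [CommRing R] [IsDomain R] [Field K]
  [Algebra R K] [IsFractionRing R K]

theorem frac_mem_one_iff (a b y : R) (ha : a ≠ 0) :
    (algebraMap R K b / algebraMap R K a) * algebraMap R K y ∈ (1 : FractionalIdeal R⁰ K)
      ↔ a ∣ b * y := by
  have ha' : algebraMap R K a ≠ 0 := by simpa using ha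
  rw [FractionalIdeal.mem_one_iff]
  constructor
  · rintro ⟨r, hr⟩
    refine ⟨r, ?_⟩
    apply IsFractionRing.injective R K
    rw [map_mul, map_mul, hr]
    field_simp
  · rintro ⟨r, hr⟩
    refine ⟨r, ?_⟩
    have := congrArg (algebraMap R K) hr
    rw [map_mul, map_mul] at this
    field_simp
    rw [this]; ring

theorem fi_inv_ne_zero (J : FractionalIdeal R⁰ K) (hJ : J ≠ 0) : J⁻¹ ≠ 0 := by
  intro h
  have := FractionalIdeal.bot_lt_mul_inv hJ
  rw [h, mul_zero] at this
  exact lt_irrefl _ this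

theorem mem_vv_iff (F : Ideal R) (hF : F ≠ ⊥) (y : R) :
    algebraMap R K y ∈ ((F : FractionalIdeal R⁰ K)⁻¹)⁻¹ ↔ InV F y := by
  have h0 : (F : FractionalIdeal R⁰ K) ≠ 0 := FractionalIdeal.coeIdeal_ne_zero.mpr hF
  rw [FractionalIdeal.mem_inv_iff (fi_inv_ne_zero _ h0)]
  constructor
  · intro h a b ha hab
    rw [← frac_mem_one_iff (K := K) a b y ha, mul_comm]
    apply h
    rw [FractionalIdeal.mem_inv_iff h0]
    intro g hg
    obtain ⟨f, hf, rfl⟩ := (FractionalIdeal.mem_coeIdeal _).mp hg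
    exact (frac_mem_one_iff a b f ha).mpr (hab f hf)
  · intro h q hq
    rw [FractionalIdeal.mem_inv_iff h0] at hq
    obtain ⟨b, a, ha, rfl⟩ := IsFractionRing.div_surjective (A := R) q
    have ha := nonZeroDivisors.ne_zero ha
    rw [mul_comm, frac_mem_one_iff a b y ha]
    apply h a b ha
    intro f hf
    exact (frac_mem_one_iff a b f ha).mp (hq _ (FractionalIdeal.mem_coeIdeal_of_mem _ hf))

theorem isTIdeal_iff (N : Ideal R) : IsTIdeal K N ↔
    ∀ F : Ideal R, F ≠ ⊥ → F.FG → F ≤ N → ∀ y, InV F y → y ∈ N := by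
  have inj := IsFractionRing.injective R K
  unfold IsTIdeal
  constructor
  · intro h F hF hfg hle y hy
    have h0 : (F : FractionalIdeal R⁰ K) ≠ 0 := FractionalIdeal.coeIdeal_ne_zero.mpr hF
    have : algebraMap R K y ∈ tOp K (N : FractionalIdeal R⁰ K) := by
      unfold tOp
      refine Submodule.mem_iSup_of_mem (F : FractionalIdeal R⁰ K) ?_
      refine Submodule.mem_iSup_of_mem h0 ?_
      refine Submodule.mem_iSup_of_mem ((FractionalIdeal.coeIdeal_le_coeIdeal K).mpr hle) ?_
      refine Submodule.mem_iSup_of_mem ((FractionalIdeal.coeIdeal_fg _ inj F).mpr hfg) ?_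
      exact (mem_vv_iff F hF y).mpr hy
    rw [h] at this
    obtain ⟨z, hz, hzy⟩ := (FractionalIdeal.mem_coeIdeal _).mp this
    rwa [← inj hzy]
  · intro h
    apply le_antisymm
    · unfold tOp
      refine iSup_le fun J => iSup_le fun hJ0 => iSup_le fun hJN => iSup_le fun hfg => ?_
      obtain ⟨F, rfl⟩ := FractionalIdeal.le_one_iff_exists_coeIdeal.mp
        (hJN.trans FractionalIdeal.coeIdeal_le_one)
      have hF : F ≠ ⊥ := FractionalIdeal.coeIdeal_ne_zero.mp hJ0
      intro q hq
      have hq' : q ∈ ((F : FractionalIdeal R⁰ K)⁻¹)⁻¹ := hq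
      have h1 := (FractionalIdeal.mem_inv_iff (fi_inv_ne_zero _ hJ0)).mp hq' 1 (by
        rw [FractionalIdeal.mem_inv_iff hJ0]
        intro y hy
        rw [one_mul]
        exact FractionalIdeal.coeIdeal_le_one hy)
      rw [mul_one, FractionalIdeal.mem_one_iff] at h1
      obtain ⟨y, rfl⟩ := h1
      exact FractionalIdeal.mem_coeIdeal_of_mem _
        (h F hF ((FractionalIdeal.coeIdeal_fg _ inj F).mp hfg)
          ((FractionalIdeal.coeIdeal_le_coeIdeal K).mp hJN) y ((mem_vv_iff F hF y).mp hq'))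
    · intro q hq
      obtain ⟨y, hy, rfl⟩ := (FractionalIdeal.mem_coeIdeal _).mp (show q ∈ (N : FractionalIdeal R⁰ K) from hq)
      by_cases hy0 : y = 0
      · subst hy0; simp
      have hF : Ideal.span {y} ≠ ⊥ := by simpa using hy0
      have h0 : ((Ideal.span {y} : Ideal R) : FractionalIdeal R⁰ K) ≠ 0 :=
        FractionalIdeal.coeIdeal_ne_zero.mpr hF
      unfold tOp
      refine Submodule.mem_iSup_of_mem ((Ideal.span {y} : Ideal R) : FractionalIdeal R⁰ K) ?_
      refine Submodule.mem_iSup_of_mem h0 ?_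
      refine Submodule.mem_iSup_of_mem ((FractionalIdeal.coeIdeal_le_coeIdeal K).mpr
        ((Ideal.span_singleton_le_iff_mem _).mpr hy)) ?_
      refine Submodule.mem_iSup_of_mem ((FractionalIdeal.coeIdeal_fg _ inj _).mpr ⟨{y}, by simp⟩) ?_
      exact (mem_vv_iff _ hF y).mpr fun a b ha hab =>
        hab y (Ideal.mem_span_singleton_self y)

theorem tOp_mono {I J : FractionalIdeal R⁰ K} (h : I ≤ J) : tOp K I ≤ tOp K J := by
  unfold tOp
  refine iSup_le fun F => iSup_le fun hJ0 => iSup_le fun hJN => iSup_le fun hfg => ?_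
  exact le_iSup_of_le F (le_iSup_of_le hJ0 (le_iSup_of_le (hJN.trans h) (le_iSup_of_le hfg le_rfl)))

/-- Valuation property at a proper t-ideal. -/
theorem val_prop (hpvmd : IsPvMD (R := R) K) (N : Ideal R) (hN : N ≠ ⊤) (hT : IsTIdeal K N)
    (a b : R) (ha : a ≠ 0) : ∃ u c : R, u ∉ N ∧ (u * b = c * a ∨ u * a = c * b) := by
  have inj := IsFractionRing.injective R K
  set F : Ideal R := Ideal.span {a, b} with hFdef
  have haF : a ∈ F := Ideal.subset_span (by simp)
  have hbF : b ∈ F := Ideal.subset_span (by simp)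
  have hF : F ≠ ⊥ := fun h => ha (by simpa [h] using haF)
  have h0 : (F : FractionalIdeal R⁰ K) ≠ 0 := FractionalIdeal.coeIdeal_ne_zero.mpr hF
  have h1 := hpvmd F hF (Submodule.fg_span (Set.toFinite _))
  by_contra hcon
  push Not at hcon
  apply hN
  have key : (F : FractionalIdeal R⁰ K) * (F : FractionalIdeal R⁰ K)⁻¹ ≤ (N : FractionalIdeal R⁰ K) := by
    rw [FractionalIdeal.mul_le]
    intro i hi q hq
    obtain ⟨f, hf, rfl⟩ := (FractionalIdeal.mem_coeIdeal _).mp hi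
    rw [FractionalIdeal.mem_inv_iff h0] at hq
    obtain ⟨r, hr⟩ := (FractionalIdeal.mem_one_iff _).mp (hq _ (FractionalIdeal.mem_coeIdeal_of_mem _ haF))
    obtain ⟨s, hs⟩ := (FractionalIdeal.mem_one_iff _).mp (hq _ (FractionalIdeal.mem_coeIdeal_of_mem _ hbF))
    have hrs : r * b = s * a := by
      apply inj
      rw [map_mul, map_mul, hr, hs]; ring
    have hrN : r ∈ N := by
      by_contra h
      exact (hcon r s h).1 hrs
    have hsN : s ∈ N := by
      by_contra h
      exact (hcon s r h).2 hrs.symm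
    obtain ⟨c, d, rfl⟩ := Ideal.mem_span_pair.mp hf
    have : algebraMap R K (c * a + d * b) * q = algebraMap R K (c * r + d * s) := by
      simp only [map_add, map_mul, hr, hs]; ring
    rw [this]
    exact FractionalIdeal.mem_coeIdeal_of_mem _ (N.add_mem (N.mul_mem_left _ hrN) (N.mul_mem_left _ hsN))
  have h2 := tOp_mono key
  rw [h1, hT] at h2
  have h3 : (1 : K) ∈ (N : FractionalIdeal R⁰ K) := h2 (Submodule.one_le.mp le_rfl)
  obtain ⟨z, hz, hz1⟩ := (FractionalIdeal.mem_coeIdeal _).mp h3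
  rw [Ideal.eq_top_iff_one]
  have : z = 1 := inj (by rw [hz1, map_one])
  rwa [← this]

theorem IsMaxTIdeal.prime {M : Ideal R} (hM : IsMaxTIdeal K M) : M.IsPrime := by
  obtain ⟨hne, hT, hmax⟩ := hM
  refine ⟨hne, ?_⟩
  intro a b hab
  by_contra hcon
  push Not at hcon
  obtain ⟨ha, hb⟩ := hcon
  let N : Ideal R := Submodule.comap (LinearMap.mulRight R b) M
  have hmem : ∀ r, r ∈ N ↔ r * b ∈ M := fun r => Iff.rfl
  have hb0 : b ≠ 0 := fun h => hb (h ▸ M.zero_mem)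
  have hNt : N ≠ ⊤ := by
    intro h
    have : (1 : R) ∈ N := h ▸ Submodule.mem_top
    rw [hmem, one_mul] at this
    exact hb this
  have hNT : IsTIdeal K N := by
    rw [isTIdeal_iff] at hT ⊢
    intro F hF hfg hle y hy
    rw [hmem]
    apply hT (Ideal.span {b} * F)
    · simp [hb0, hF]
    · exact Submodule.FG.mul ⟨{b}, by simp⟩ hfg
    · rw [Ideal.span_singleton_mul_le_iff]
      intro z hz
      rw [mul_comm]
      exact hle hz
    · intro a' b' ha' h
      have := hy a' (b' * b) ha' (fun f hf => by
        rw [mul_assoc]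
        exact h _ (Ideal.mul_mem_mul (Ideal.mem_span_singleton_self b) hf))
      convert this using 1; ring
  have := hmax N hNt hNT (fun r hr => M.mul_mem_right b hr)
  apply ha
  rw [this]
  exact hab

theorem mem_locMul (M : Ideal R) [M.IsPrime] (A : Submodule R K) (y : K) :
    y ∈ locMul K M A ↔ ∃ t : R, t ∉ M ∧ t • y ∈ A := by
  let B : Submodule R K :=
    { carrier := {y | ∃ t : R, t ∉ M ∧ t • y ∈ A}
      add_mem' := by
        rintro y z ⟨s, hs, hy⟩ ⟨t, ht, hz⟩
        refine ⟨s * t, fun h => (Ideal.IsPrime.mem_or_mem ‹_› h).elim hs ht, ?_⟩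
        rw [smul_add]
        refine A.add_mem ?_ ?_
        · rw [mul_comm, mul_smul]; exact A.smul_mem _ hy
        · rw [mul_smul]; exact A.smul_mem _ hz
      zero_mem' := ⟨1, fun h => Ideal.IsPrime.ne_top ‹_› ((Ideal.eq_top_iff_one _).mpr h), by simp⟩
      smul_mem' := by
        rintro r y ⟨s, hs, hy⟩
        exact ⟨s, hs, by rw [smul_comm]; exact A.smul_mem _ hy⟩ }
  have ht0 : ∀ t : R, t ∉ M → algebraMap R K t ≠ 0 := by
    intro t ht h
    have : t = 0 := by simpa using h
    exact ht (this ▸ M.zero_mem)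
  suffices locMul K M A = B by rw [this]; rfl
  apply le_antisymm
  · refine iSup_le fun t => iSup_le fun ht => ?_
    rw [Submodule.mul_le]
    intro m hm n hn
    obtain ⟨r, rfl⟩ := Submodule.mem_span_singleton.mp hm
    refine ⟨t, ht, ?_⟩
    have : t • (r • (algebraMap R K t)⁻¹ * n) = r • n := by
      simp only [Algebra.smul_def]
      have := ht0 t ht
      field_simp
    rw [this]
    exact A.smul_mem _ hn
  · rintro y ⟨t, ht, hy⟩
    refine Submodule.mem_iSup_of_mem t (Submodule.mem_iSup_of_mem ht ?_)
    have : y = (algebraMap R K t)⁻¹ * t • y := by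
      rw [Algebra.smul_def]
      have := ht0 t ht
      field_simp
    rw [this]
    exact Submodule.mul_mem_mul (Submodule.mem_span_singleton_self _) hy

theorem mem_locMul_coe (M : Ideal R) [M.IsPrime] (A : Ideal R) (y : R) :
    algebraMap R K y ∈ locMul K M ((A : FractionalIdeal R⁰ K) : Submodule R K)
      ↔ ∃ t : R, t ∉ M ∧ t * y ∈ A := by
  rw [mem_locMul]
  refine exists_congr fun t => and_congr_right fun _ => ?_
  rw [Algebra.smul_def, ← map_mul]
  change algebraMap R K (t * y) ∈ (A : FractionalIdeal R⁰ K) ↔ _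
  rw [FractionalIdeal.mem_coeIdeal]
  constructor
  · rintro ⟨z, hz, h⟩
    rwa [← IsFractionRing.injective R K h]
  · intro h
    exact ⟨_, h, rfl⟩

theorem mem_contrLoc (P : Ideal R) [P.IsPrime] (x y : R) :
    y ∈ contrLoc K P x ↔ ∃ t : R, t ∉ P ∧ x ∣ t * y := by
  unfold contrLoc
  rw [Submodule.mem_comap, mem_locMul]
  refine exists_congr fun t => and_congr_right fun _ => ?_
  rw [Algebra.linearMap_apply, Algebra.smul_def, ← map_mul, Submodule.mem_map]
  constructor
  · rintro ⟨z, hz, h⟩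
    rw [← IsFractionRing.injective R K h]
    exact Ideal.mem_span_singleton.mp hz
  · intro h
    exact ⟨_, Ideal.mem_span_singleton.mpr h, rfl⟩

theorem locMul_le (M : Ideal R) [M.IsPrime] (A B : Ideal R)
    (h : ∀ a ∈ A, ∃ t : R, t ∉ M ∧ t * a ∈ B) :
    locMul K M ((A : FractionalIdeal R⁰ K) : Submodule R K) ≤
      locMul K M ((B : FractionalIdeal R⁰ K) : Submodule R K) := by
  intro y hy
  rw [mem_locMul] at hy
  obtain ⟨s, hs, hy⟩ := hy
  obtain ⟨a, ha, hay⟩ := (FractionalIdeal.mem_coeIdeal _).mp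
    (show s • y ∈ (A : FractionalIdeal R⁰ K) from hy)
  obtain ⟨t, ht, hta⟩ := h a ha
  rw [mem_locMul]
  refine ⟨t * s, fun h => (Ideal.IsPrime.mem_or_mem ‹_› h).elim ht hs, ?_⟩
  rw [mul_smul, ← hay, Algebra.smul_def, ← map_mul]
  exact FractionalIdeal.mem_coeIdeal_of_mem _ hta

theorem exists_pow_contr (x : R) (P : Ideal R) [P.IsPrime]
    (hP : P ∈ (Ideal.span {x} : Ideal R).minimalPrimes) : P ≤ (contrLoc K P x).radical := by
  intro p hp
  have h := IsLocalization.AtPrime.radical_map_of_mem_minimalPrimes (Localization.AtPrime P) P _ hP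
  have h2 : algebraMap R (Localization.AtPrime P) p ∈
      (Ideal.map (algebraMap R (Localization.AtPrime P)) (Ideal.span {x})).radical := by
    rw [h]
    exact Ideal.mem_map_of_mem _ hp
  obtain ⟨n, hn⟩ := h2
  rw [← map_pow, IsLocalization.algebraMap_mem_map_algebraMap_iff P.primeCompl] at hn
  obtain ⟨t, ht, h⟩ := hn
  refine ⟨n, ?_⟩
  rw [mem_contrLoc]
  exact ⟨t, ht, Ideal.mem_span_singleton.mp h⟩

theorem exists_common (x : R) (P : Ideal R) [P.IsPrime] (F : Ideal R) (hF : F.FG)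
    (h : F ≤ contrLoc K P x) : ∃ s : R, s ∉ P ∧ ∀ f ∈ F, x ∣ s * f := by
  induction F, hF using Submodule.fg_induction with
  | singleton a =>
    obtain ⟨t, ht, hta⟩ := (mem_contrLoc P x a).mp (h (Submodule.mem_span_singleton_self a))
    refine ⟨t, ht, fun f hf => ?_⟩
    obtain ⟨r, rfl⟩ := Submodule.mem_span_singleton.mp hf
    rw [smul_eq_mul, mul_left_comm]
    exact Dvd.dvd.mul_left hta r
  | sup A B _ _ hA hB =>
    obtain ⟨s, hs, h1⟩ := hA (le_sup_left.trans h)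
    obtain ⟨t, ht, h2⟩ := hB (le_sup_right.trans h)
    refine ⟨s * t, fun h => (Ideal.IsPrime.mem_or_mem ‹_› h).elim hs ht, fun f hf => ?_⟩
    obtain ⟨a, ha, b, hb, rfl⟩ := Submodule.mem_sup.mp hf
    have : s * t * (a + b) = t * (s * a) + s * (t * b) := by ring
    rw [this]
    exact dvd_add (Dvd.dvd.mul_left (h1 a ha) _) (Dvd.dvd.mul_left (h2 b hb) _)

theorem inV_pow (x : R) (hx : x ≠ 0) (F : Ideal R) (y : R) (hy : InV F y) (k : ℕ) :
    ∀ z : R, (∀ f ∈ F ^ k, x ∣ z * f) → x ∣ z * y ^ k := by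
  induction k with
  | zero =>
    intro z h
    have := h 1 (by simp)
    simpa using this
  | succ k ih =>
    intro z h
    have := ih (z * y) (fun f hf => by
      have := hy x (z * f) hx (fun g hg => by
        rw [mul_assoc]
        exact h _ (by rw [pow_succ]; exact Ideal.mul_mem_mul hf hg))
      convert this using 1; ring)
    convert this using 1; ring

theorem isTIdeal_minimal (x : R) (hx : x ≠ 0) (P : Ideal R) [P.IsPrime]
    (hP : P ∈ (Ideal.span {x} : Ideal R).minimalPrimes) : IsTIdeal K P := by
  have hxP : x ∈ P := hP.1.2 (Ideal.mem_span_singleton_self x)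
  rw [isTIdeal_iff]
  intro F hF hfg hle y hy
  obtain ⟨n, hn⟩ := Ideal.exists_pow_le_of_le_radical_of_fg
    (hle.trans (exists_pow_contr (K := K) x P hP)) hfg
  obtain ⟨s, hs, h⟩ := exists_common (K := K) x P (F ^ n) (Submodule.FG.pow hfg n) hn
  have := P.mem_of_dvd (inV_pow x hx F y hy n s h) hxP
  exact Ideal.IsPrime.mem_of_pow_mem ‹_› n ((Ideal.IsPrime.mem_or_mem ‹_› this).resolve_left hs)

theorem exists_maxT (P : Ideal R) (hPt : P ≠ ⊤) (hT : IsTIdeal K P) :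
    ∃ M : Ideal R, IsMaxTIdeal K M ∧ P ≤ M := by
  obtain ⟨M, hPM, hM⟩ := zorn_le_nonempty₀ {N : Ideal R | N ≠ ⊤ ∧ IsTIdeal K N} (by
    intro c hc hchain N₀ hN₀
    have hdir : DirectedOn (· ≤ ·) c := hchain.directedOn
    have hmem : ∀ y, y ∈ sSup c ↔ ∃ N ∈ c, y ∈ N :=
      fun y => Submodule.mem_sSup_of_directed ⟨N₀, hN₀⟩ hdir
    refine ⟨sSup c, ⟨?_, ?_⟩, fun z hz => le_sSup hz⟩
    · intro h
      obtain ⟨N, hN, h1⟩ := (hmem 1).mp (h ▸ Submodule.mem_top)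
      exact (hc hN).1 ((Ideal.eq_top_iff_one _).mpr h1)
    · rw [isTIdeal_iff]
      intro F hF hfg hle y hy
      have : ∃ N ∈ c, F ≤ N := by
        clear hy hF
        induction F, hfg using Submodule.fg_induction with
        | singleton a =>
          obtain ⟨N, hN, ha⟩ := (hmem a).mp (hle (Submodule.mem_span_singleton_self a))
          exact ⟨N, hN, (Submodule.span_singleton_le_iff_mem _ _).mpr ha⟩
        | sup A B _ _ hA hB =>
          obtain ⟨N, hN, h1⟩ := hA (le_sup_left.trans hle)
          obtain ⟨N', hN', h2⟩ := hB (le_sup_right.trans hle)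
          obtain ⟨L, hL, h3, h4⟩ := hdir N hN N' hN'
          exact ⟨L, hL, sup_le (h1.trans h3) (h2.trans h4)⟩
      obtain ⟨N, hN, hFN⟩ := this
      exact (hmem y).mpr ⟨N, hN, (isTIdeal_iff N).mp (hc hN).2 F hF hfg hFN y hy⟩) P ⟨hPt, hT⟩
  refine ⟨M, ⟨hM.prop.1, hM.prop.2, fun N h1 h2 h3 => ?_⟩, hPM⟩
  exact le_antisymm h3 (hM.le_of_ge ⟨h1, h2⟩ h3)

/-- Division of `x * _` at a maximal t-ideal containing `P`. -/
theorem div_step (hpvmd : IsPvMD (R := R) K) (x : R) (P N : Ideal R) [P.IsPrime]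
    (hN : IsMaxTIdeal K N) (hPN : P ≤ N) (a t : R) (ha : a ∈ contrLoc K P x) (haP : a ∈ P)
    (ht : t ∉ P) : ∃ u c : R, u ∉ N ∧ c ∈ contrLoc K P x ∧ u * a = c * t := by
  have ht0 : t ≠ 0 := fun h => ht (h ▸ P.zero_mem)
  obtain ⟨u, c, hu, h | h⟩ := val_prop hpvmd N hN.1 hN.2.1 t a ht0
  · refine ⟨u, c, hu, ?_, h⟩
    obtain ⟨s, hs, hsa⟩ := (mem_contrLoc P x a).mp ha
    rw [mem_contrLoc]
    refine ⟨s * t, fun h => (Ideal.IsPrime.mem_or_mem ‹_› h).elim hs ht, ?_⟩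
    have : s * t * c = u * (s * a) := by linear_combination -s * h
    rw [this]
    exact Dvd.dvd.mul_left hsa u
  · exfalso
    have : u * t ∈ P := h ▸ P.mul_mem_left c haP
    exact (Ideal.IsPrime.mem_or_mem ‹_› this).elim (fun h => hu (hPN h)) ht

/-- `I² ⊆ x I R_N`. -/
theorem sq_step (hpvmd : IsPvMD (R := R) K) (x : R) (hx0 : x ≠ 0) (P N : Ideal R) [P.IsPrime]
    (hIP : contrLoc K P x ≤ P)
    (hN : IsMaxTIdeal K N) (hPN : P ≤ N) (i : R) (hi : i ∈ contrLoc K P x * contrLoc K P x) :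
    ∃ v k : R, v ∉ N ∧ k ∈ contrLoc K P x ∧ v * i = x * k := by
  have hNp := hN.prime
  refine Submodule.mul_induction_on hi ?_ ?_
  · intro a ha b hb
    obtain ⟨t, ht, r, hr⟩ := (mem_contrLoc P x b).mp hb
    obtain ⟨u, c, hu, hc, h⟩ := div_step hpvmd x P N hN hPN a t ha (hIP ha) ht
    refine ⟨u, r * c, hu, Ideal.mul_mem_left _ _ hc, ?_⟩
    linear_combination b * h + c * hr
  · rintro a b ⟨v, k, hv, hk, h⟩ ⟨v', k', hv', hk', h'⟩
    refine ⟨v * v', v' * k + v * k', fun h => (hNp.mem_or_mem h).elim hv hv',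
      Ideal.add_mem _ (Ideal.mul_mem_left _ _ hk) (Ideal.mul_mem_left _ _ hk'), ?_⟩
    linear_combination v' * h + v * h'

end helpers

/-- Let `R` be a PvMD (not a field), `x` a nonzero nonunit of `R`, `P` a prime minimal over
`xR`, and `I = xR_P ∩ R`.  If `I` is `w`-basic, then `P` is a maximal `t`-ideal of `R`. -/
theorem isMaxTIdeal_of_w_basic_contraction
    {R K : Type*} [CommRing R] [IsDomain R] [Field K] [Algebra R K] [IsFractionRing R K]
    (hnf : ¬ IsField R) (hpvmd : IsPvMD (R := R) K)
    (x : R) (hx0 : x ≠ 0) (hxu : ¬ IsUnit x)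
    (P : Ideal R) (hP : P ∈ (Ideal.span {x} : Ideal R).minimalPrimes)
    (hbasic : ∀ J : Ideal R, J ≠ ⊥ → J ≤ contrLoc K P x →
      (∃ n : ℕ, wOp K ((J : FractionalIdeal R⁰ K)
            * ((contrLoc K P x : Ideal R) : FractionalIdeal R⁰ K) ^ n)
          = wOp K (((contrLoc K P x : Ideal R) : FractionalIdeal R⁰ K) ^ (n + 1))) →
      wOp K (J : FractionalIdeal R⁰ K)
        = wOp K ((contrLoc K P x : Ideal R) : FractionalIdeal R⁰ K)) :
    IsMaxTIdeal K P := by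
  have hPp : P.IsPrime := hP.1.1
  have hxP : x ∈ P := hP.1.2 (Ideal.mem_span_singleton_self x)
  have h1P : (1 : R) ∉ P := fun h => hPp.ne_top ((Ideal.eq_top_iff_one _).mpr h)
  obtain ⟨M, hM, hPM⟩ := exists_maxT (K := K) P hPp.ne_top (isTIdeal_minimal x hx0 P hP)
  have hrad := exists_pow_contr (K := K) x P hP
  have hsq := sq_step (K := K) hpvmd x hx0 P
  have hdiv := div_step (K := K) hpvmd x P
  have hmemI := mem_contrLoc (K := K) P x
  generalize contrLoc K P x = I at *
  have hIP : I ≤ P := by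
    intro a ha
    obtain ⟨t, ht, h⟩ := (hmemI a).mp ha
    exact (hPp.mem_or_mem (P.mem_of_dvd h hxP)).resolve_left ht
  have hxI : x ∈ I := (hmemI x).mpr ⟨1, h1P, by simp⟩
  set J : Ideal R := Ideal.span {x} ⊔ I * I with hJ
  have hxJ : x ∈ J := Ideal.mem_sup_left (Ideal.mem_span_singleton_self x)
  have hJI : J ≤ I := sup_le ((Ideal.span_singleton_le_iff_mem _).mpr hxI) Ideal.mul_le_left
  have hw := hbasic J (fun h => hx0 (by simpa [h] using hxJ)) hJI ⟨1, by
    rw [← FractionalIdeal.coeIdeal_pow, ← FractionalIdeal.coeIdeal_mul,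
      ← FractionalIdeal.coeIdeal_pow]
    simp only [pow_one, Nat.reduceAdd, pow_two]
    unfold wOp
    refine iInf_congr fun N => iInf_congr fun hN => ?_
    have hNp := hN.prime
    have h1N : (1 : R) ∉ N := fun h => hNp.ne_top ((Ideal.eq_top_iff_one _).mpr h)
    apply le_antisymm
    · exact locMul_le N _ _ fun a ha => ⟨1, h1N, by
        rw [one_mul]; exact Ideal.mul_mono_left hJI ha⟩
    · refine locMul_le N _ _ fun a ha => ?_
      by_cases hPN : P ≤ N
      · obtain ⟨v, k, hv, hk, h⟩ := hsq N hIP hN hPN a ha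
        exact ⟨v, hv, h ▸ Ideal.mul_mem_mul hxJ hk⟩
      · obtain ⟨p, hp, hpN⟩ := Set.not_subset.mp hPN
        obtain ⟨n, hn⟩ := hrad hp
        have hsN : p ^ n ∉ N := fun h => hpN (hNp.mem_of_pow_mem n h)
        refine ⟨p ^ n * p ^ n, fun h => (hNp.mem_or_mem h).elim hsN hsN, ?_⟩
        exact Ideal.mul_mem_mul (Ideal.mem_sup_right (Ideal.mul_mem_mul hn hn))
          (Ideal.mul_le_left ha)⟩
  have hMp := hM.prime
  suffices P = M by rw [this]; exact hM
  refine le_antisymm hPM fun m hm => ?_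
  by_contra hmP
  obtain ⟨u, c, hu, hc, h⟩ := hdiv M hM hPM x m hxI hxP hmP
  have hcI : algebraMap R K c ∈ wOp K (I : FractionalIdeal R⁰ K) := by
    unfold wOp
    simp only [Submodule.mem_iInf]
    intro N hN
    have hNp := hN.prime
    rw [mem_locMul_coe]
    exact ⟨1, fun h => hNp.ne_top ((Ideal.eq_top_iff_one _).mpr h), by simpa using hc⟩
  rw [← hw] at hcI
  unfold wOp at hcI
  simp only [Submodule.mem_iInf] at hcI
  obtain ⟨w, hwM, hwc⟩ := (mem_locMul_coe M J c).mp (hcI M hM)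
  obtain ⟨y, hy, i, hi, hyi⟩ := Submodule.mem_sup.mp hwc
  obtain ⟨r, rfl⟩ := Ideal.mem_span_singleton.mp hy
  obtain ⟨v, k, hv, hk, hvk⟩ := hsq M hIP hM hPM i hi
  have hfin : u * w * v = m * (r * v + k) := by
    apply mul_left_cancel₀ hx0
    linear_combination w * v * h - v * m * hyi + m * hvk
  have : u * w * v ∈ M := hfin ▸ M.mul_mem_right _ hm
  exact (hMp.mem_or_mem this).elim (fun h => (hMp.mem_or_mem h).elim hu hwM) hv
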